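/- Cassini's identity for even indices: for every natural number m ≥ 1, Q̃_{2m−2}·Q̃_{2m+2} − Q̃_{2m}² = [((ab)² − β⁴)·α*·β* + ((ab)² − α⁴)·β*·α*]/((ab)²·(α − β)²) + ε·[ (α**·β*·α + α*·β**·β)·((ab)² − β⁴) + (β*·α**·α + β**·α*·β)·((ab)² − α⁴) ]/((ab)²·(α − β)²). -/

import Mathlib

open Quaternion TrivSqZeroExt

/-- The bi-periodic Fibonacci sequence: `F 0 = 0`, `F 1 = 1`, and
`F n = a * F (n-1) + F (n-2)` if `n` is even, `F n = b * F (n-1) + F (n-2)` if `n` is odd. -/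
noncomputable def biF (a b : ℝ) : ℕ → ℝ
  | 0 => 0
  | 1 => 1
  | n + 2 => (if Even (n + 2) then a else b) * biF a b (n + 1) + biF a b n

/-- The bi-periodic Fibonacci quaternion `Q n = F n + F (n+1) i + F (n+2) j + F (n+3) k`. -/
noncomputable def biQ (a b : ℝ) (n : ℕ) : ℍ[ℝ] :=
  ⟨biF a b n, biF a b (n + 1), biF a b (n + 2), biF a b (n + 3)⟩

/-- The bi-periodic dual Fibonacci quaternion `Q̃ n = Q n + ε * Q (n+1)`,
an element of the dual numbers over the quaternions. -/
noncomputable def biDQ (a b : ℝ) (n : ℕ) : DualNumber ℍ[ℝ] :=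
  inl (biQ a b n) + DualNumber.eps * inl (biQ a b (n + 1))

section Binet

variable {a b α β : ℝ}

/-- Binet's formula for even and odd indices: `x + 1 = x ^ 2 / (a * b)` for each root `x`. -/
theorem biF_binet (hα : α ^ 2 = a * b * (α + 1)) (hβ : β ^ 2 = a * b * (β + 1)) (hne : α ≠ β)
    (k : ℕ) :
    biF a b (2 * k) = (α - β)⁻¹ * ((α + 1) ^ k * a - (β + 1) ^ k * a) ∧
      biF a b (2 * k + 1) = (α - β)⁻¹ * ((α + 1) ^ k * α - (β + 1) ^ k * β) := by
  have hd : α - β ≠ 0 := sub_ne_zero.mpr hne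
  induction k with
  | zero => simp [biF, hd]
  | succ k ih =>
    obtain ⟨h0, h1⟩ := ih
    have h2 : biF a b (2 * (k + 1)) = a * biF a b (2 * k + 1) + biF a b (2 * k) := by
      rw [show 2 * (k + 1) = 2 * k + 2 by ring, biF, if_pos (by simp [parity_simps])]
    have h3 : biF a b (2 * (k + 1) + 1) = b * biF a b (2 * (k + 1)) + biF a b (2 * k + 1) := by
      rw [show 2 * (k + 1) + 1 = 2 * k + 1 + 2 by ring, biF, if_neg (by simp [parity_simps])]
      rfl
    have h2' : biF a b (2 * (k + 1)) =
        (α - β)⁻¹ * ((α + 1) ^ (k + 1) * a - (β + 1) ^ (k + 1) * a) := by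
      rw [h2, h0, h1]; ring
    refine ⟨h2', ?_⟩
    rw [h3, h2', h1]
    linear_combination (α - β)⁻¹ * ((β + 1) ^ k * hβ - (α + 1) ^ k * hα)

/-- The even-index Binet quaternion `x*`, with powers of the root `x` reduced. -/
noncomputable def evenFactor (a x : ℝ) : ℍ[ℝ] := ⟨a, x, a * (x + 1), x * (x + 1)⟩

/-- The odd-index Binet quaternion `x • x**`, with powers of the root `x` reduced. -/
noncomputable def oddFactor (a x : ℝ) : ℍ[ℝ] := ⟨x, a * (x + 1), x * (x + 1), a * (x + 1) ^ 2⟩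

theorem biQ_even (hα : α ^ 2 = a * b * (α + 1)) (hβ : β ^ 2 = a * b * (β + 1)) (hne : α ≠ β)
    (k : ℕ) :
    biQ a b (2 * k) = (α - β)⁻¹ • ((α + 1) ^ k • evenFactor a α - (β + 1) ^ k • evenFactor a β) := by
  obtain ⟨h0, h1⟩ := biF_binet hα hβ hne k
  obtain ⟨h2, h3⟩ := biF_binet hα hβ hne (k + 1)
  rw [show 2 * (k + 1) = 2 * k + 2 by ring] at h2 h3
  ext <;> simp only [Quaternion.re_smul, Quaternion.imI_smul, Quaternion.imJ_smul,
    Quaternion.imK_smul, Quaternion.re_sub, Quaternion.imI_sub, Quaternion.imJ_sub,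
    Quaternion.imK_sub, smul_eq_mul] <;> simp only [biQ, evenFactor, h0, h1, h2, h3] <;> ring

theorem biQ_odd (hα : α ^ 2 = a * b * (α + 1)) (hβ : β ^ 2 = a * b * (β + 1)) (hne : α ≠ β)
    (k : ℕ) :
    biQ a b (2 * k + 1) = (α - β)⁻¹ •
      ((α + 1) ^ k • oddFactor a α - (β + 1) ^ k • oddFactor a β) := by
  obtain ⟨-, h1⟩ := biF_binet hα hβ hne k
  obtain ⟨h2, h3⟩ := biF_binet hα hβ hne (k + 1)
  obtain ⟨h4, -⟩ := biF_binet hα hβ hne (k + 2)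
  rw [show 2 * (k + 1) = 2 * k + 2 by ring] at h2 h3
  rw [show 2 * (k + 2) = 2 * k + 1 + 3 by ring] at h4
  ext <;> simp only [Quaternion.re_smul, Quaternion.imI_smul, Quaternion.imJ_smul,
    Quaternion.imK_smul, Quaternion.re_sub, Quaternion.imI_sub, Quaternion.imJ_sub,
    Quaternion.imK_sub, smul_eq_mul] <;> simp only [biQ, oddFactor, h1, h2, h3, h4] <;> ring

theorem eq_evenFactor {x : ℝ} {z : ℍ[ℝ]} (hab : a * b ≠ 0) (hx : x ^ 2 = a * b * (x + 1))
    (hz : z = ⟨a, x, a / (a * b) * x ^ 2, 1 / (a * b) * x ^ 3⟩) : z = evenFactor a x := by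
  have ha : a ≠ 0 := left_ne_zero_of_mul hab
  have hb : b ≠ 0 := right_ne_zero_of_mul hab
  rw [hz, pow_succ x 2, hx]
  ext <;> simp only [evenFactor] <;> field_simp

theorem smul_eq_oddFactor {x : ℝ} {z : ℍ[ℝ]} (hab : a * b ≠ 0) (hx : x ^ 2 = a * b * (x + 1))
    (hz : z = ⟨1, a / (a * b) * x, 1 / (a * b) * x ^ 2, a / (a * b) ^ 2 * x ^ 3⟩) :
    x • z = oddFactor a x := by
  have ha : a ≠ 0 := left_ne_zero_of_mul hab
  have hb : b ≠ 0 := right_ne_zero_of_mul hab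
  have h1 : x * (a / (a * b) * x) = a / (a * b) * x ^ 2 := by ring
  have h3 : x * (a / (a * b) ^ 2 * x ^ 3) = a / (a * b) ^ 2 * (x ^ 2) ^ 2 := by ring
  ext <;> simp only [Quaternion.re_smul, Quaternion.imI_smul, Quaternion.imJ_smul,
    Quaternion.imK_smul, smul_eq_mul] <;> simp only [hz, oddFactor, mul_one, h1, h3, hx] <;>
    field_simp

end Binet

/-- Cassini's identity for two Binet-type sequences in an algebra, whose roots `p` and `q` satisfy
`p * q = 1`. -/
theorem cassini_of_binet {R A : Type*} [CommRing R] [Ring A] [Algebra R A] {p q : R}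
    (hpq : p * q = 1) (c : R) (u v u' v' : A) (k : ℕ) :
    (c • (p ^ k • u - q ^ k • v)) * (c • (p ^ (k + 2) • u' - q ^ (k + 2) • v')) -
        (c • (p ^ (k + 1) • u - q ^ (k + 1) • v)) * (c • (p ^ (k + 1) • u' - q ^ (k + 1) • v')) =
      c ^ 2 • ((1 - q ^ 2) • (u * v') + (1 - p ^ 2) • (v * u')) := by
  have hk : p ^ k * q ^ k = 1 := by rw [← mul_pow, hpq, one_pow]
  simp only [mul_sub, sub_mul, smul_mul_assoc, mul_smul_comm]
  match_scalars
  · ring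
  · linear_combination c ^ 2 * ((p * q - p ^ 2) * hk + hpq)
  · linear_combination c ^ 2 * ((p * q - q ^ 2) * hk + hpq)
  · ring

/-- Cassini's identity for the bi-periodic dual Fibonacci quaternions, even indices. -/
theorem biDQ_cassini_even (a b : ℝ) (hab : 0 < a * b) (α β : ℝ)
    (hα : α = (a * b + Real.sqrt ((a * b) ^ 2 + 4 * (a * b))) / 2)
    (hβ : β = (a * b - Real.sqrt ((a * b) ^ 2 + 4 * (a * b))) / 2)
    (αs βs αss βss : ℍ[ℝ])
    (hαs : αs = ⟨a, α, a / (a * b) * α ^ 2, 1 / (a * b) * α ^ 3⟩)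
    (hβs : βs = ⟨a, β, a / (a * b) * β ^ 2, 1 / (a * b) * β ^ 3⟩)
    (hαss : αss = ⟨1, a / (a * b) * α, 1 / (a * b) * α ^ 2, a / (a * b) ^ 2 * α ^ 3⟩)
    (hβss : βss = ⟨1, a / (a * b) * β, 1 / (a * b) * β ^ 2, a / (a * b) ^ 2 * β ^ 3⟩)
    (m : ℕ) (hm : 1 ≤ m) :
    biDQ a b (2 * m - 2) * biDQ a b (2 * m + 2) - (biDQ a b (2 * m)) ^ 2 =
      inl (((((a * b) ^ 2 - β ^ 4 : ℝ) : ℍ[ℝ]) * (αs * βs)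
            + (((a * b) ^ 2 - α ^ 4 : ℝ) : ℍ[ℝ]) * (βs * αs))
          / (((a * b) ^ 2 * (α - β) ^ 2 : ℝ) : ℍ[ℝ]))
        + DualNumber.eps *
          inl (((αss * βs * ((α : ℝ) : ℍ[ℝ]) + αs * βss * ((β : ℝ) : ℍ[ℝ]))
                  * (((a * b) ^ 2 - β ^ 4 : ℝ) : ℍ[ℝ])
                + (βs * αss * ((α : ℝ) : ℍ[ℝ]) + βss * αs * ((β : ℝ) : ℍ[ℝ]))
                  * (((a * b) ^ 2 - α ^ 4 : ℝ) : ℍ[ℝ]))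
              / (((a * b) ^ 2 * (α - β) ^ 2 : ℝ) : ℍ[ℝ])) := by
  obtain ⟨k, rfl⟩ := Nat.exists_eq_add_of_le' hm
  have hpos : 0 < (a * b) ^ 2 + 4 * (a * b) := by positivity
  have hsq := Real.sq_sqrt hpos.le
  have hroot : 0 < Real.sqrt ((a * b) ^ 2 + 4 * (a * b)) := Real.sqrt_pos.mpr hpos
  have hα2 : α ^ 2 = a * b * (α + 1) := by rw [hα]; linear_combination hsq / 4
  have hβ2 : β ^ 2 = a * b * (β + 1) := by rw [hβ]; linear_combination hsq / 4
  have hne : α ≠ β := by rw [hα, hβ]; intro h; linarith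
  have hpq : (α + 1) * (β + 1) = 1 := by rw [hα, hβ]; linear_combination -hsq / 4
  clear hα hβ
  have hs : a * b ≠ 0 := hab.ne'
  have coeff (x : ℝ) (hx : x ^ 2 = a * b * (x + 1)) :
      (a * b) ^ 2 - x ^ 4 = (a * b) ^ 2 * (1 - (x + 1) ^ 2) := by
    linear_combination (-(x ^ 2) - a * b * (x + 1)) * hx
  have even_eq (n : ℕ) : biQ a b (2 * n) = (α - β)⁻¹ • ((α + 1) ^ n • αs - (β + 1) ^ n • βs) := by
    rw [biQ_even hα2 hβ2 hne, eq_evenFactor hs hα2 hαs, eq_evenFactor hs hβ2 hβs]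
  have odd_eq (n : ℕ) : biQ a b (2 * n + 1) =
      (α - β)⁻¹ • ((α + 1) ^ n • α • αss - (β + 1) ^ n • β • βss) := by
    rw [biQ_odd hα2 hβ2 hne, smul_eq_oddFactor hs hα2 hαss, smul_eq_oddFactor hs hβ2 hβss]
  have scale (z : ℍ[ℝ]) : (a * b) ^ 2 • z / (((a * b) ^ 2 * (α - β) ^ 2 : ℝ) : ℍ[ℝ]) =
      (α - β)⁻¹ ^ 2 • z := by
    rw [div_eq_mul_inv, ← Quaternion.coe_inv, Quaternion.mul_coe_eq_smul, smul_smul]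
    congr 1
    field_simp
    exact div_self hs
  rw [show 2 * (k + 1) - 2 = 2 * k by omega, show 2 * (k + 1) + 2 = 2 * (k + 2) by ring]
  simp only [coeff α hα2, coeff β hβ2, Quaternion.coe_mul_eq_smul, Quaternion.mul_coe_eq_smul,
    mul_smul _ (1 - _ : ℝ), ← smul_add, scale]
  simp only [biDQ, even_eq, odd_eq]
  ext1
  · simpa [sq] using cassini_of_binet hpq (α - β)⁻¹ αs βs αs βs k
  · have h1 := cassini_of_binet hpq (α - β)⁻¹ αs βs (α • αss) (β • βss) k
    have h2 := cassini_of_binet hpq (α - β)⁻¹ (α • αss) (β • βss) αs βs k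
    simp only [smul_mul_assoc, mul_smul_comm] at h1 h2
    simp [sq]
    linear_combination (norm := module) h1 + h2
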